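/- Algebraic half of the interpretation of gropes via the lower central series: Let X be a set and let T be an abstract grope whose leaves are labelled by elements of X, with boundary word γ(T) ∈ F_X and class k = class(T). Then γ(T) lies in the k-th lower central series term (F_X)^k of the free group F_X. -/

import Mathlib

universe u

open scoped commutatorElement

mutual
/-- An abstract grope with leaves labelled by `X`: either a leaf, or a node carrying a
nonempty finite list of pairs of abstract gropes. -/
inductive AbGrope (X : Type u) : Type u
  | leaf : X → AbGrope X
  | node : AbGropePairs X → AbGrope X

/-- A nonempty list of pairs of abstract gropes. -/
inductive AbGropePairs (X : Type u) : Type u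
  | single : AbGrope X → AbGrope X → AbGropePairs X
  | cons : AbGrope X → AbGrope X → AbGropePairs X → AbGropePairs X
end

mutual
/-- The class of an abstract grope: `1` for a leaf, and for a node the minimum over its
pairs `(A, B)` of `class A + class B`. -/
def gropeClass {X : Type u} : AbGrope X → ℕ
  | .leaf _ => 1
  | .node ps => pairsClass ps

def pairsClass {X : Type u} : AbGropePairs X → ℕ
  | .single a b => gropeClass a + gropeClass b
  | .cons a b t => min (gropeClass a + gropeClass b) (pairsClass t)
end

mutual
/-- The boundary word of an abstract grope in the free group on its labels:
a leaf gives its label, a node gives the product of commutators of the boundary words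
of its pairs. -/
def gropeBoundary {X : Type u} : AbGrope X → FreeGroup X
  | .leaf x => FreeGroup.of x
  | .node ps => pairsBoundary ps

def pairsBoundary {X : Type u} : AbGropePairs X → FreeGroup X
  | .single a b => ⁅gropeBoundary a, gropeBoundary b⁆
  | .cons a b t => ⁅gropeBoundary a, gropeBoundary b⁆ * pairsBoundary t
end

mutual
/-- The list of leaf labels of an abstract grope, from left to right. -/
def gropeLeaves {X : Type u} : AbGrope X → List X
  | .leaf x => [x]
  | .node ps => pairsLeaves ps

def pairsLeaves {X : Type u} : AbGropePairs X → List X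
  | .single a b => gropeLeaves a ++ gropeLeaves b
  | .cons a b t => gropeLeaves a ++ gropeLeaves b ++ pairsLeaves t
end

theorem three_subgroups_le {G : Type*} [Group G] (H₁ H₂ H₃ N : Subgroup G) [N.Normal]
    (h1 : ⁅⁅H₂, H₃⁆, H₁⁆ ≤ N) (h2 : ⁅⁅H₃, H₁⁆, H₂⁆ ≤ N) : ⁅⁅H₁, H₂⁆, H₃⁆ ≤ N := by
  have key : ∀ K : Subgroup G, K ≤ N ↔ K.map (QuotientGroup.mk' N) = ⊥ := fun K => by
    rw [Subgroup.map_eq_bot_iff, QuotientGroup.ker_mk']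
  rw [key] at h1 h2 ⊢
  simp only [Subgroup.map_commutator] at h1 h2 ⊢
  exact Subgroup.commutator_commutator_eq_bot_of_rotate h1 h2

theorem commutator_lcs_le {G : Type*} [Group G] (n m : ℕ) :
    ⁅(⊤ : Subgroup G).lowerCentralSeries n, (⊤ : Subgroup G).lowerCentralSeries m⁆ ≤
      (⊤ : Subgroup G).lowerCentralSeries (n + m + 1) := by
  induction n generalizing m with
  | zero =>
    rw [Subgroup.lowerCentralSeries_zero, Subgroup.commutator_comm, Nat.zero_add,
      Subgroup.lowerCentralSeries_succ]
  | succ n ih =>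
    rw [Subgroup.lowerCentralSeries_succ]
    apply three_subgroups_le
    · rw [Subgroup.commutator_comm ⊤, ← Subgroup.lowerCentralSeries_succ,
        Subgroup.commutator_comm]
      exact (ih (m + 1)).trans (le_of_eq (congrArg _ (by omega)))
    · rw [Subgroup.commutator_comm (Subgroup.lowerCentralSeries ⊤ m)]
      refine (Subgroup.commutator_mono (ih m) le_rfl).trans ?_
      rw [← Subgroup.lowerCentralSeries_succ]
      exact le_of_eq (congrArg _ (by omega))

mutual
theorem gropeClass_pos {X : Type u} : (T : AbGrope X) → 1 ≤ gropeClass T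
  | .leaf _ => by simp [gropeClass]
  | .node ps => by
    have := pairsClass_pos ps
    simpa [gropeClass] using this

theorem pairsClass_pos {X : Type u} : (T : AbGropePairs X) → 1 ≤ pairsClass T
  | .single a b => by
    have := gropeClass_pos a
    simp only [pairsClass]; omega
  | .cons a b t => by
    have := gropeClass_pos a
    have := pairsClass_pos t
    simp only [pairsClass]; omega
end

theorem commutator_mem_aux {G : Type*} [Group G] {x y : G} {a b k : ℕ} (ha : 1 ≤ a) (hb : 1 ≤ b)
    (hx : x ∈ (⊤ : Subgroup G).lowerCentralSeries (a - 1))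
    (hy : y ∈ (⊤ : Subgroup G).lowerCentralSeries (b - 1)) (hk : k ≤ a + b) :
    ⁅x, y⁆ ∈ (⊤ : Subgroup G).lowerCentralSeries (k - 1) :=
  Subgroup.lowerCentralSeries_antitone ⊤ (by omega : k - 1 ≤ (a - 1) + (b - 1) + 1)
    (commutator_lcs_le _ _ (Subgroup.commutator_mem_commutator hx hy))

mutual
theorem gropeBoundary_mem_aux {X : Type u} : (T : AbGrope X) →
    gropeBoundary T ∈ Subgroup.lowerCentralSeries (⊤ : Subgroup (FreeGroup X)) (gropeClass T - 1)
  | .leaf _ => by simp [gropeClass]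
  | .node ps => by
    have := pairsBoundary_mem_aux ps
    simpa only [gropeClass, gropeBoundary] using this

theorem pairsBoundary_mem_aux {X : Type u} : (T : AbGropePairs X) →
    pairsBoundary T ∈ Subgroup.lowerCentralSeries (⊤ : Subgroup (FreeGroup X)) (pairsClass T - 1)
  | .single a b => by
    have ha := gropeBoundary_mem_aux a
    have hb := gropeBoundary_mem_aux b
    simp only [pairsClass, pairsBoundary]
    exact commutator_mem_aux (gropeClass_pos a) (gropeClass_pos b) ha hb le_rfl
  | .cons a b t => by
    have ha := gropeBoundary_mem_aux a
    have hb := gropeBoundary_mem_aux b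
    have ht := pairsBoundary_mem_aux t
    simp only [pairsClass, pairsBoundary]
    exact mul_mem
      (commutator_mem_aux (gropeClass_pos a) (gropeClass_pos b) ha hb (min_le_left _ _))
      (Subgroup.lowerCentralSeries_antitone ⊤ (Nat.sub_le_sub_right (min_le_right _ _) 1) ht)
end

/-- Algebraic half of the interpretation of gropes via the lower central series: the
boundary word of an abstract grope of class `k` lies in the `k`-th lower central series
term `(F_X)^k = lowerCentralSeries (F_X) (k - 1)` of the free group on the labels. -/
theorem gropeBoundary_mem_lowerCentralSeries {X : Type u} (T : AbGrope X) :
    gropeBoundary T ∈ Subgroup.lowerCentralSeries (⊤ : Subgroup (FreeGroup X)) (gropeClass T - 1) := by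
  exact gropeBoundary_mem_aux T
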